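/- Let Θ and Ω be Polish spaces and let ψ : Θ → (finite nonnegative Borel measures on Ω) be continuous with respect to the narrow topology, with uniformly bounded total masses (there exists C such that ψ(θ)(Ω) ≤ C for all θ ∈ Θ). Then the parametric mixing operator Mix_Θ, which sends a finite nonnegative Borel measure ν on Θ to the finite nonnegative Borel measure on Ω defined by Mix_Θ(ν)(A) = ∫_Θ ψ(θ)(A) ν(dθ) for every Borel A ⊆ Ω, is continuous from the space of finite nonnegative Borel measures on Θ with the narrow topology to the space of finite nonnegative Borel measures on Ω with the narrow topology. -/

import Mathlib

open MeasureTheory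
open scoped ENNReal NNReal

open scoped BoundedContinuousFunction in
/-- A narrowly continuous family of finite measures is measurable for the Giry σ-algebra. -/
lemma measurable_toMeasure_of_continuous
    {Θ : Type*} [TopologicalSpace Θ] [MeasurableSpace Θ] [BorelSpace Θ]
    {Ω : Type*} [TopologicalSpace Ω] [HasOuterApproxClosed Ω] [MeasurableSpace Ω] [BorelSpace Ω]
    {ψ : Θ → FiniteMeasure Ω} (hψ : Continuous ψ) :
    Measurable fun θ ↦ (ψ θ : Measure Ω) := by
  have h_closed (F : Set Ω) (hF : IsClosed F) : Measurable fun θ ↦ (ψ θ : Measure Ω) F := by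
    refine measurable_of_tendsto_metrizable
      (f := fun n θ ↦ ∫⁻ x, hF.apprSeq n x ∂(ψ θ : Measure Ω)) (fun n ↦ ?_) ?_
    · exact (FiniteMeasure.continuous_iff_forall_continuous_lintegral.1 hψ _).measurable
    · exact tendsto_pi_nhds.2 fun θ ↦
        HasOuterApproxClosed.tendsto_lintegral_apprSeq hF (ψ θ : Measure Ω)
  refine Measurable.measure_of_isPiSystem ?_ isPiSystem_isClosed h_closed
    (h_closed _ isClosed_univ)
  rw [BorelSpace.measurable_eq (α := Ω), borel_eq_generateFrom_isClosed]

open scoped BoundedContinuousFunction in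
/-- Integrating a bounded continuous function against a narrowly continuous family of measures of
uniformly bounded mass yields a bounded continuous function of the parameter. -/
lemma exists_boundedContinuousFunction_eq_lintegral
    {Θ : Type*} [TopologicalSpace Θ]
    {Ω : Type*} [TopologicalSpace Ω] [MeasurableSpace Ω] [OpensMeasurableSpace Ω]
    {ψ : Θ → FiniteMeasure Ω} (hψ : Continuous ψ)
    {C : ℝ≥0} (hbdd : ∀ θ : Θ, (ψ θ).mass ≤ C) (f : Ω →ᵇ ℝ≥0) :
    ∃ g : Θ →ᵇ ℝ≥0, ∀ θ, (g θ : ℝ≥0∞) = ∫⁻ x, f x ∂(ψ θ : Measure Ω) := by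
  have h_le (θ : Θ) : (ψ θ).testAgainstNN f ≤ nndist f 0 * C := by
    have h := (ψ θ).testAgainstNN_lipschitz_estimate f 0
    rw [FiniteMeasure.testAgainstNN_zero, zero_add] at h
    exact h.trans (by gcongr; exact hbdd θ)
  refine ⟨.mkOfBound ⟨fun θ ↦ (ψ θ).testAgainstNN f,
    (FiniteMeasure.continuous_testAgainstNN_eval f).comp hψ⟩ (nndist f 0 * C : ℝ≥0)
      fun θ θ' ↦ ?_, fun θ ↦ FiniteMeasure.testAgainstNN_coe_eq⟩
  rw [NNReal.dist_eq]
  exact abs_sub_le_of_nonneg_of_le (NNReal.coe_nonneg _) (by exact_mod_cast h_le θ)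
    (NNReal.coe_nonneg _) (by exact_mod_cast h_le θ')

/-- **Theorem.** Let `Θ` and `Ω` be Polish spaces and let
`ψ : Θ → (finite nonnegative Borel measures on Ω)` be continuous for the narrow topology,
with uniformly bounded total masses. Then the parametric mixing operator `Mix_Θ`, sending a
finite nonnegative Borel measure `ν` on `Θ` to the finite nonnegative Borel measure on `Ω`
given by `A ↦ ∫ ψ(θ)(A) ν(dθ)`, is continuous with respect to the narrow topologies. -/
theorem parametric_mixing_operator_continuous
    {Θ : Type*} [TopologicalSpace Θ] [PolishSpace Θ] [MeasurableSpace Θ] [BorelSpace Θ]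
    {Ω : Type*} [TopologicalSpace Ω] [PolishSpace Ω] [MeasurableSpace Ω] [BorelSpace Ω]
    (ψ : Θ → FiniteMeasure Ω) (hψ : Continuous ψ)
    (C : ℝ≥0) (hbdd : ∀ θ : Θ, (ψ θ : Measure Ω) Set.univ ≤ (C : ℝ≥0∞)) :
    ∃ MixΘ : FiniteMeasure Θ → FiniteMeasure Ω,
      Continuous MixΘ ∧
        ∀ (ν : FiniteMeasure Θ) (A : Set Ω), MeasurableSet A →
          (MixΘ ν : Measure Ω) A = ∫⁻ θ, (ψ θ : Measure Ω) A ∂(ν : Measure Θ) := by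
  have h_meas := measurable_toMeasure_of_continuous hψ
  have h_mass (θ : Θ) : (ψ θ).mass ≤ C := by
    rw [← ENNReal.coe_le_coe, FiniteMeasure.ennreal_mass]
    exact hbdd θ
  have h_fin (ν : FiniteMeasure Θ) :
      IsFiniteMeasure ((ν : Measure Θ).bind fun θ ↦ (ψ θ : Measure Ω)) := by
    refine ⟨?_⟩
    rw [Measure.bind_apply MeasurableSet.univ h_meas.aemeasurable]
    refine (lintegral_mono hbdd).trans_lt ?_
    rw [lintegral_const]
    exact ENNReal.mul_lt_top ENNReal.coe_lt_top (measure_lt_top _ _)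
  refine ⟨fun ν ↦ ⟨_, h_fin ν⟩, ?_, fun ν A hA ↦ Measure.bind_apply hA h_meas.aemeasurable⟩
  refine FiniteMeasure.continuous_iff_forall_continuous_lintegral.2 fun f ↦ ?_
  obtain ⟨g, hg⟩ := exists_boundedContinuousFunction_eq_lintegral hψ h_mass f
  convert FiniteMeasure.continuous_lintegral_boundedContinuousFunction g using 2 with ν
  rw [FiniteMeasure.toMeasure_mk, Measure.lintegral_bind h_meas.aemeasurable
    (by fun_prop)]
  exact lintegral_congr fun θ ↦ (hg θ).symm
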